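/- Let p ≥ 5 and let M be a nonzero A-module lying in EIP_2 (i.e., M has the equal images property and 𝔪²M = 0). Then for every integer n ≥ 1, no minimal 2n-th syzygy of M has the equal images property. -/

import Mathlib

open MvPolynomial Module

set_option maxHeartbeats 1000000
set_option synthInstance.maxHeartbeats 400000

noncomputable section

/-- The defining ideal `(X^p, Y^p)` of the polynomial ring in two variables. -/
def relI (k : Type) [Field k] (p : ℕ) : Ideal (MvPolynomial (Fin 2) k) :=
  Ideal.span {(X 0 : MvPolynomial (Fin 2) k) ^ p, (X 1 : MvPolynomial (Fin 2) k) ^ p}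

/-- The algebra `A = k[X,Y]/(X^p, Y^p)`. -/
abbrev Amod (k : Type) [Field k] (p : ℕ) : Type :=
  MvPolynomial (Fin 2) k ⧸ relI k p

variable (k : Type) [Field k] (p : ℕ)

/-- `x`, the image of `X` in `A`. -/
def xA : Amod k p := Ideal.Quotient.mk (relI k p) (X 0)

/-- `y`, the image of `Y` in `A`. -/
def yA : Amod k p := Ideal.Quotient.mk (relI k p) (X 1)

/-- The maximal ideal `𝔪 = (x, y)` of `A`. -/
def mA : Ideal (Amod k p) := Ideal.span {xA k p, yA k p}

/-- A point operator: `u = α x + β y` with `(α, β) ≠ (0, 0)`. -/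
def IsPointOp (u : Amod k p) : Prop :=
  ∃ α β : k, (α ≠ 0 ∨ β ≠ 0) ∧ u = α • xA k p + β • yA k p

/-- Equal images property: `u M = 𝔪 M` for every point operator `u`. -/
def EIP (M : Type) [AddCommGroup M] [Module (Amod k p) M] : Prop :=
  ∀ u : Amod k p, IsPointOp k p u →
    LinearMap.range (LinearMap.lsmul (Amod k p) M u)
      = mA k p • (⊤ : Submodule (Amod k p) M)

/-- `M` lies in `EIP_d`: equal images property and `𝔪^d M = 0`. -/
def EIPd (d : ℕ) (M : Type) [AddCommGroup M] [Module (Amod k p) M] : Prop :=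
  EIP k p M ∧ (mA k p) ^ d • (⊤ : Submodule (Amod k p) M) = ⊥


/-- `IsMinSyz m N M`: the `A`-module `N` is a minimal `m`-th syzygy of `M`, i.e. it arises
(up to isomorphism) as the last kernel `ker(F_{m−1} → F_{m−2})` of an exact sequence
`F_{m−1} → ⋯ → F_1 → F_0 → M → 0` of finitely generated free `A`-modules `F_i` with
`ker(F_0 → M) ⊆ 𝔪F_0` and `ker(F_i → F_{i−1}) ⊆ 𝔪F_i`; equivalently, it is obtained by
`m`-fold iteration of minimal first syzygies. -/
def IsMinSyz : ℕ → ModuleCat.{0} (Amod k p) → ModuleCat.{0} (Amod k p) → Prop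
  | 0, N, M => Nonempty ((↥N) ≃ₗ[Amod k p] (↥M))
  | (m + 1), N, M => ∃ (r : ℕ) (g : (Fin r → Amod k p) →ₗ[Amod k p] M),
      Function.Surjective g ∧
      LinearMap.ker g ≤ mA k p • (⊤ : Submodule (Amod k p) (Fin r → Amod k p)) ∧
      IsMinSyz m N (ModuleCat.of (Amod k p) (↥(LinearMap.ker g)))

section gen
variable {R : Type*} [CommRing R]

def subl {V : Type*} [AddCommGroup V] [Module R V] (Z B : Submodule R V) : ℕ∞ :=
  Module.length R (Z ⧸ B.submoduleOf Z)

lemma subl_le {V W : Type*} [AddCommGroup V] [Module R V] [AddCommGroup W] [Module R W]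
    (Z₁ B₁ : Submodule R V) (Z₂ B₂ : Submodule R W) (Q : Submodule R (V × W))
    (h1 : ∀ z ∈ Z₁, ∃ w ∈ Z₂, (z, w) ∈ Q)
    (h2 : ∀ z ∈ Z₁, ∀ w ∈ Z₂, (z, w) ∈ Q → w ∈ B₂ → z ∈ B₁) :
    subl Z₁ B₁ ≤ subl Z₂ B₂ := by
  let T : Submodule R (V × W) := Q ⊓ Z₁.prod Z₂
  let f0 : T →ₗ[R] Z₁ := ((LinearMap.fst R V W).comp T.subtype).codRestrict Z₁ (fun t => t.2.2.1)
  let g0 : T →ₗ[R] Z₂ := ((LinearMap.snd R V W).comp T.subtype).codRestrict Z₂ (fun t => t.2.2.2)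
  let f : T →ₗ[R] (Z₁ ⧸ B₁.submoduleOf Z₁) := (B₁.submoduleOf Z₁).mkQ.comp f0
  let g : T →ₗ[R] (Z₂ ⧸ B₂.submoduleOf Z₂) := (B₂.submoduleOf Z₂).mkQ.comp g0
  have hf : Function.Surjective f := by
    intro q
    obtain ⟨z, rfl⟩ := Submodule.mkQ_surjective _ q
    obtain ⟨w, hw, hq⟩ := h1 z z.2
    exact ⟨⟨(z, w), hq, z.2, hw⟩, rfl⟩
  have hk : LinearMap.ker g ≤ LinearMap.ker f := by
    intro t ht
    have h3 : (t : V × W).2 ∈ B₂ := by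
      have := (Submodule.Quotient.mk_eq_zero _).1 (show (B₂.submoduleOf Z₂).mkQ (g0 t) = 0 from ht)
      exact this
    have h4 : (t : V × W).1 ∈ B₁ := h2 _ t.2.2.1 _ t.2.2.2 t.2.1 h3
    exact (Submodule.Quotient.mk_eq_zero _).2 (show f0 t ∈ B₁.submoduleOf Z₁ from h4)
  have a1 : Module.length R (Z₁ ⧸ B₁.submoduleOf Z₁) ≤ Module.length R (T ⧸ LinearMap.ker g) :=
    Module.length_le_of_surjective ((LinearMap.ker g).liftQ f hk) (by
      intro q; obtain ⟨t, rfl⟩ := hf q; exact ⟨Submodule.Quotient.mk t, rfl⟩)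
  have a2 : Module.length R (T ⧸ LinearMap.ker g) ≤ Module.length R (Z₂ ⧸ B₂.submoduleOf Z₂) :=
    Module.length_le_of_injective ((LinearMap.ker g).liftQ g le_rfl) (by
      rw [← LinearMap.ker_eq_bot]; exact Submodule.ker_liftQ_eq_bot _ _ _ le_rfl)
  exact a1.trans a2

/-- exponent of the periodic resolution -/
def ee (p s : ℕ) : ℕ := if s % 2 = 1 then 1 else p - 1

lemma ee_add {p : ℕ} (hp : 1 ≤ p) (s : ℕ) : ee p s + ee p (s + 1) = p := by
  unfold ee; split_ifs <;> omega

lemma ee_add' {p : ℕ} (hp : 1 ≤ p) (s : ℕ) : ee p (s + 1) + ee p s = p := by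
  unfold ee; split_ifs <;> omega

lemma ee_one (p : ℕ) : ee p 1 = 1 := rfl
lemma ee_even (p n : ℕ) : ee p (2 * n) = p - 1 := by simp [ee]
lemma ee_pos {p : ℕ} (hp : 2 ≤ p) (s : ℕ) : 1 ≤ ee p s := by
  unfold ee; split_ifs <;> omega

variable (x y : R) (p : ℕ)

def dC (V : Type*) [AddCommGroup V] [Module R V] (i : ℕ) : (ℕ → V) →ₗ[R] (ℕ → V) where
  toFun z := fun s => x ^ ee p (s + 1) • z (s + 1) + ((-1) ^ s * y ^ ee p (i - s)) • z s
  map_add' a b := by ext s; simp only [Pi.add_apply, smul_add]; abel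
  map_smul' a b := by
    ext s; simp only [Pi.smul_apply, smul_add, RingHom.id_apply]
    rw [smul_comm a, smul_comm a]

lemma dC_apply (V : Type*) [AddCommGroup V] [Module R V] (i : ℕ) (z : ℕ → V) (s : ℕ) :
    dC x y p V i z s = x ^ ee p (s + 1) • z (s + 1) + ((-1) ^ s * y ^ ee p (i - s)) • z s := rfl

def ZC (V : Type*) [AddCommGroup V] [Module R V] (i : ℕ) : Submodule R (ℕ → V) where
  carrier := {z | ∀ s < i, dC x y p V i z s = 0}
  add_mem' := by intro a b ha hb s hs; simp [ha s hs, hb s hs]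
  zero_mem' := by intro s hs; simp
  smul_mem' := by intro c a ha s hs; simp [ha s hs]

def BC (V : Type*) [AddCommGroup V] [Module R V] (i : ℕ) : Submodule R (ℕ → V) where
  carrier := {z | ∃ w, ∀ s ≤ i, z s = dC x y p V (i + 1) w s}
  add_mem' := by
    rintro a b ⟨w, hw⟩ ⟨v, hv⟩; exact ⟨w + v, fun s hs => by simp [hw s hs, hv s hs]⟩
  zero_mem' := ⟨0, by simp⟩
  smul_mem' := by rintro c a ⟨w, hw⟩; exact ⟨c • w, fun s hs => by simp [hw s hs]⟩

variable {x y p}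

lemma dC_dC (hp : 1 ≤ p) (hx : x ^ p = 0) (hy : y ^ p = 0) (V : Type*) [AddCommGroup V] [Module R V] (i : ℕ)
    (w : ℕ → V) (s : ℕ) (hs : s < i) : dC x y p V i (dC x y p V (i + 1) w) s = 0 := by
  obtain ⟨t, rfl⟩ : ∃ t, i = s + t := ⟨i - s, by omega⟩
  simp only [dC_apply, smul_add, smul_smul]
  rw [show s + t + 1 - (s + 1) = t by omega, show s + t - s = t by omega,
    show s + t + 1 - s = t + 1 by omega]
  rw [← pow_add x, ee_add hp, hx, zero_smul,
    show (-1 : R) ^ s * y ^ ee p t * ((-1) ^ s * y ^ ee p (t + 1))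
      = (-1) ^ s * (-1) ^ s * (y ^ (ee p t + ee p (t + 1))) by ring, ee_add hp, hy, mul_zero,
      zero_smul, zero_add, add_zero, ← add_smul,
      show x ^ ee p (s + 1) * ((-1) ^ (s + 1) * y ^ ee p t) + (-1) ^ s * y ^ ee p t * x ^ ee p (s + 1) = 0 by ring,
      zero_smul]

lemma dC_congr {V : Type*} [AddCommGroup V] [Module R V] (i : ℕ) {a b : ℕ → V} {s : ℕ} (h : a s = b s)
   (h' : a (s+1) = b (s+1)) : dC x y p V i a s = dC x y p V i b s := by
  simp only [dC_apply, h, h']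

lemma dC_map {V W : Type*} [AddCommGroup V] [Module R V] [AddCommGroup W] [Module R W] (f : V →ₗ[R] W)
   (i : ℕ) (a : ℕ → V) (s : ℕ) : f (dC x y p V i a s) = dC x y p W i (fun t => f (a t)) s := by
  simp [dC_apply]

/-- The properties of free modules that are used. -/
structure GoodF (x y : R) (p : ℕ) (F : Type*) [AddCommGroup F] [Module R F] : Prop where
  xk : ∀ j ≤ p, ∀ f : F, x ^ j • f = 0 → ∃ g : F, f = x ^ (p - j) • g
  yk : ∀ j ≤ p, ∀ f g : F, y ^ j • f = x • g → ∃ a b : F, f = x • a + y ^ (p - j) • b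

lemma cyc_bd (hp : 2 ≤ p) (hy : y ^ p = 0) {F : Type*} [AddCommGroup F] [Module R F]
    (hF : GoodF x y p F) (i : ℕ) (hi : 1 ≤ i) : ZC x y p F i ≤ BC x y p F i := by
  intro z hz
  have hle : ∀ s, ee p s ≤ p := fun s => by have := ee_add (p := p) (by omega) s; omega
  have key : ∀ j ≤ i, ∃ w : ℕ → F, ∀ s ≤ j, z s = dC x y p F (i + 1) w s := by
    intro j
    induction j with
    | zero =>
      intro _
      have h0 := hz 0 (by omega)
      rw [dC_apply] at h0
      obtain ⟨a, b, hab⟩ := hF.yk (ee p i) (hle i) (z 0) (-(z 1)) (by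
        have : y ^ ee p i • z 0 + x • z 1 = 0 := by
          rw [← h0]; simp [ee_one]; abel
        rw [smul_neg]; exact eq_neg_of_add_eq_zero_left this)
      refine ⟨fun s => if s = 0 then b else a, ?_⟩
      intro s hs
      obtain rfl : s = 0 := by omega
      rw [dC_apply, hab]
      have : p - ee p i = ee p (i + 1) := by have := ee_add (p := p) (by omega) i; omega
      simp [ee_one, this]
    | succ s ih =>
      intro hs
      obtain ⟨w, hw⟩ := ih (by omega)
      obtain ⟨t, rfl⟩ : ∃ t, i = s + t := ⟨i - s, by omega⟩
      have h0 := hz s (by omega)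
      rw [dC_apply, hw s le_rfl, dC_apply, show s + t + 1 - s = t + 1 by omega,
        show s + t - s = t by omega, smul_add, smul_smul, smul_smul,
        show (-1 : R) ^ s * y ^ ee p t * ((-1) ^ s * y ^ ee p (t + 1))
        = (-1) ^ s * (-1) ^ s * (y ^ (ee p t + ee p (t + 1))) by ring, ee_add (by omega), hy, mul_zero,
        zero_smul, add_zero, mul_comm _ (x ^ _), ← smul_smul, ← smul_add] at h0
      obtain ⟨g, hg⟩ := hF.xk _ (hle _) _ h0
      refine ⟨Function.update w (s + 2) g, ?_⟩
      intro r hr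
      rcases Nat.lt_or_ge s r with h | h
      · obtain rfl : r = s + 1 := by omega
        rw [dC_apply, Function.update_of_ne (show s + 1 ≠ s + 2 by omega), show s + 1 + 1 = s + 2 from rfl,
          Function.update_self]
        have : p - ee p (s + 1) = ee p (s + 1 + 1) := by
          have := ee_add (p := p) (by omega) (s + 1); omega
        rw [this] at hg
        rw [show s + 2 = s + 1 + 1 from rfl, ← hg, show s + t + 1 - (s + 1) = t by omega, pow_succ]
        simp
      · rw [hw r h]
        apply dC_congr
        · rw [Function.update_of_ne (by omega)]
        · rw [Function.update_of_ne (by omega)]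
  exact key i le_rfl

/-- dimension shift -/
lemma shift_H (hp : 2 ≤ p) (hx : x ^ p = 0) (hy : y ^ p = 0) {F M : Type*} [AddCommGroup F] [Module R F]
    [AddCommGroup M] [Module R M] (hF : GoodF x y p F) (g : F →ₗ[R] M) (hg : Function.Surjective g) (i : ℕ) :
    subl (ZC x y p M (i + 1)) (BC x y p M (i + 1)) ≤
      subl (ZC x y p (LinearMap.ker g) i) (BC x y p (LinearMap.ker g) i) := by
  let Q : Submodule R ((ℕ → M) × (ℕ → LinearMap.ker g)) :=
    { carrier := {q | ∃ f : ℕ → F, (∀ s, g (f s) = q.1 s) ∧ ∀ s ≤ i, (q.2 s : F) = dC x y p F (i + 1) f s}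
      add_mem' := by
        rintro a b ⟨f, h1, h2⟩ ⟨f', h1', h2'⟩
        exact ⟨f + f', fun s => by simp [h1, h1'], fun s hs => by simp [h2 s hs, h2' s hs]⟩
      zero_mem' := ⟨0, by simp, by simp⟩
      smul_mem' := by
        rintro c a ⟨f, h1, h2⟩
        exact ⟨c • f, fun s => by simp [h1], fun s hs => by simp [h2 s hs]⟩ }
  refine subl_le _ _ _ _ Q ?_ ?_
  · intro z hz
    choose f hf using fun s => hg (z s)
    have hk : ∀ s, s ≤ i → dC x y p F (i + 1) f s ∈ LinearMap.ker g := by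
      intro s hs
      rw [LinearMap.mem_ker, dC_map]
      simp only [hf]
      exact hz s (by omega)
    let w : ℕ → LinearMap.ker g := fun s => if h : s ≤ i then ⟨_, hk s h⟩ else 0
    have hw : ∀ s ≤ i, (w s : F) = dC x y p F (i + 1) f s := by
      intro s hs; simp [w, hs]
    refine ⟨w, ?_, f, hf, hw⟩
    intro s hs
    apply Subtype.ext
    have := dC_map (x := x) (y := y) (p := p) (LinearMap.ker g).subtype i w s
    simp only [Submodule.subtype_apply] at this
    rw [this, Submodule.coe_zero, ← dC_dC (p := p) (by omega) hx hy F i f s hs]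
    exact dC_congr i (hw s (by omega)) (hw (s + 1) (by omega))
  · rintro z hz w hw ⟨f, hf1, hf2⟩ ⟨v, hv⟩
    have hc : (fun s => f s - (v s : F)) ∈ ZC x y p F (i + 1) := by
      intro s hs
      have e1 : (fun s => f s - (v s : F)) = f - fun s => (v s : F) := rfl
      rw [e1, map_sub, Pi.sub_apply, ← hf2 s (by omega)]
      simp only
      rw [hv s (by omega)]
      have := dC_map (x := x) (y := y) (p := p) (LinearMap.ker g).subtype (i + 1) v s
      simp only [Submodule.subtype_apply] at this
      rw [this, sub_self]
    obtain ⟨u, hu⟩ := cyc_bd hp hy hF (i + 1) (by omega) hc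
    refine ⟨fun s => g (u s), fun s hs => ?_⟩
    rw [← dC_map, ← hu s hs, map_sub, hf1]
    simp

/-- T_j -/
def KX (x : R) (V : Type*) [AddCommGroup V] [Module R V] (j : ℕ) : Submodule R V :=
  LinearMap.ker (LinearMap.lsmul R V (x ^ j))
def IX (x : R) (V : Type*) [AddCommGroup V] [Module R V] (j : ℕ) : Submodule R V :=
  LinearMap.range (LinearMap.lsmul R V (x ^ j))

lemma mem_KX {V : Type*} [AddCommGroup V] [Module R V] {j : ℕ} {v : V} : v ∈ KX x V j ↔ x ^ j • v = 0 := Iff.rfl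
lemma mem_IX {V : Type*} [AddCommGroup V] [Module R V] {j : ℕ} {v : V} :
  v ∈ IX x V j ↔ ∃ w, x ^ j • w = v := Iff.rfl

lemma shift_T (hx : x ^ p = 0) {F M : Type*} [AddCommGroup F] [Module R F]
    [AddCommGroup M] [Module R M] (hF : GoodF x y p F) (g : F →ₗ[R] M) (hg : Function.Surjective g)
    (j : ℕ) (hj : j ≤ p) :
    subl (KX x (LinearMap.ker g) j) (IX x (LinearMap.ker g) (p - j)) ≤
    subl (KX x M (p - j)) (IX x M j) := by
  let Q : Submodule R (LinearMap.ker g × M) :=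
    { carrier := {q | ∃ f : F, g f = q.2 ∧ (q.1 : F) = x ^ (p - j) • f}
      add_mem' := by
        rintro a b ⟨f, h1, h2⟩ ⟨f', h1', h2'⟩
        exact ⟨f + f', by simp [h1, h1'], by simp [h2, h2']⟩
      zero_mem' := ⟨0, by simp, by simp⟩
      smul_mem' := by
        rintro c a ⟨f, h1, h2⟩
        exact ⟨c • f, by simp [h1], by simp [h2, smul_comm c]⟩ }
  refine subl_le _ _ _ _ Q ?_ ?_
  · intro z hz
    obtain ⟨f, hf⟩ := hF.xk j hj (z : F) (congrArg Subtype.val (mem_KX.1 hz))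
    refine ⟨g f, ?_, f, rfl, hf⟩
    rw [mem_KX, ← map_smul, ← hf]
    exact z.2
  · rintro z hz w hw ⟨f, h1, h2⟩ ⟨m, hm⟩
    obtain ⟨f', rfl⟩ := hg m
    refine ⟨⟨f - x ^ j • f', ?_⟩, ?_⟩
    · rw [LinearMap.mem_ker, map_sub, map_smul]
      simp only at h1
      rw [h1, ← hm]; simp
    · apply Subtype.ext
      simp only at h2
      rw [h2]
      simp [smul_sub, smul_smul, ← pow_add, show p - j + j = p by omega, hx]

/-- only Jordan blocks of size 1, 2, p -/
def PP (x : R) (p : ℕ) (V : Type*) [AddCommGroup V] [Module R V] : Prop :=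
  ∀ v : V, x ^ 3 • v = 0 → ∃ w : V, x ^ 2 • v = x ^ (p - 1) • w
/-- only Jordan blocks of size p-2, p-1, p -/
def PQ (x : R) (p : ℕ) (V : Type*) [AddCommGroup V] [Module R V] : Prop :=
  ∀ v : V, x ^ (p - 3) • v = 0 → ∃ w : V, v = x • w

lemma PQ_of_PP (hp : 3 ≤ p) (hx : x ^ p = 0) {F M : Type*} [AddCommGroup F] [Module R F]
    [AddCommGroup M] [Module R M] (hF : GoodF x y p F) (g : F →ₗ[R] M) (hg : Function.Surjective g)
    (h : PP x p M) : PQ x p (LinearMap.ker g) := by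
  intro v hv
  obtain ⟨f, hf⟩ := hF.xk (p - 3) (by omega) (v : F) (congrArg Subtype.val hv)
  rw [show p - (p - 3) = 3 by omega] at hf
  obtain ⟨m, hm⟩ := h (g f) (by rw [← map_smul, ← hf]; exact v.2)
  obtain ⟨f', rfl⟩ := hg m
  refine ⟨⟨x ^ 2 • f - x ^ (p - 1) • f', ?_⟩, ?_⟩
  · rw [LinearMap.mem_ker, map_sub, map_smul, map_smul, hm, sub_self]
  · apply Subtype.ext
    rw [hf]
    simp [smul_sub, smul_smul, ← pow_succ', show p - 1 + 1 = p by omega, hx]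

lemma PP_of_PQ (hp : 3 ≤ p) (hx : x ^ p = 0) {F M : Type*} [AddCommGroup F] [Module R F]
    [AddCommGroup M] [Module R M] (hF : GoodF x y p F) (g : F →ₗ[R] M) (hg : Function.Surjective g)
    (h : PQ x p M) : PP x p (LinearMap.ker g) := by
  intro v hv
  obtain ⟨f, hf⟩ := hF.xk 3 (by omega) (v : F) (congrArg Subtype.val hv)
  obtain ⟨m, hm⟩ := h (g f) (by rw [← map_smul, ← hf]; exact v.2)
  obtain ⟨f', rfl⟩ := hg m
  refine ⟨⟨f - x • f', ?_⟩, ?_⟩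
  · rw [LinearMap.mem_ker, map_sub, map_smul, hm, sub_self]
  · apply Subtype.ext
    simp only [Submodule.coe_smul, hf, smul_sub, smul_smul, ← pow_add, ← pow_succ]
    simp [show p - 1 + 1 = p by omega, show 2 + (p - 3) = p - 1 by omega, hx]

lemma subl_bot {V : Type*} [AddCommGroup V] [Module R V] (Z B : Submodule R V) (hB : B = ⊥) :
    subl Z B = Module.length R Z := by
  subst hB
  apply LinearEquiv.length_eq
  apply Submodule.quotEquivOfEqBot
  rw [Submodule.submoduleOf, Submodule.comap_bot, Submodule.ker_subtype]

/-- top vs kernel -/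
lemma length_top_eq_ker {V : Type*} [AddCommGroup V] [Module R V] [IsNoetherian R V] [IsArtinian R V]
    (f : V →ₗ[R] V) :
    Module.length R (V ⧸ LinearMap.range f) = Module.length R (LinearMap.ker f) := by
  have h1 := Module.length_eq_add_of_exact (LinearMap.range f).subtype (LinearMap.range f).mkQ
    (Submodule.injective_subtype _) (Submodule.mkQ_surjective _)
    (LinearMap.exact_subtype_mkQ _)
  have h2 := Module.length_eq_add_of_exact (LinearMap.ker f).subtype f.rangeRestrict
    (Submodule.injective_subtype _) f.surjective_rangeRestrict
    (by rw [LinearMap.exact_iff]; simp)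
  rw [h1, add_comm] at h2
  exact (ENat.add_left_injective_of_ne_top (Module.length_ne_top (R := R) (M := LinearMap.range f))) h2

lemma subl_congr {V W : Type*} [AddCommGroup V] [Module R V] [AddCommGroup W] [Module R W] (e : V ≃ₗ[R] W)
    (Z₁ B₁ : Submodule R V) (Z₂ B₂ : Submodule R W) (hZ : ∀ z ∈ Z₁, e z ∈ Z₂) (hB : ∀ z, e z ∈ B₂ → z ∈ B₁) :
    subl Z₁ B₁ ≤ subl Z₂ B₂ := by
  refine subl_le _ _ _ _ (e.toLinearMap.graph) ?_ ?_
  · intro z hz; exact ⟨e z, hZ z hz, by simp [LinearMap.mem_graph_iff]⟩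
  · intro z hz w hw hq hb
    rw [LinearMap.mem_graph_iff] at hq
    simp only [LinearEquiv.coe_coe] at hq
    exact hB z (hq ▸ hb)

lemma congr_H {V W : Type*} [AddCommGroup V] [Module R V] [AddCommGroup W] [Module R W] (e : V ≃ₗ[R] W) (i : ℕ) :
    subl (ZC x y p V i) (BC x y p V i) ≤ subl (ZC x y p W i) (BC x y p W i) := by
  refine subl_congr (LinearEquiv.piCongrRight fun _ => e) _ _ _ _ ?_ ?_
  · intro z hz s hs
    have := dC_map (x := x) (y := y) (p := p) e.toLinearMap i z s
    rw [hz s hs, map_zero] at this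
    exact this.symm
  · rintro z ⟨w, hw⟩
    refine ⟨fun s => e.symm (w s), fun s hs => ?_⟩
    have := dC_map (x := x) (y := y) (p := p) e.symm.toLinearMap (i + 1) w s
    rw [← hw s hs] at this
    exact (e.symm_apply_apply (z s)).symm.trans this

lemma congr_T {V W : Type*} [AddCommGroup V] [Module R V] [AddCommGroup W] [Module R W] (e : V ≃ₗ[R] W) (i j : ℕ) :
    subl (KX x V i) (IX x V j) ≤ subl (KX x W i) (IX x W j) := by
  refine subl_congr e _ _ _ _ ?_ ?_
  · intro z hz
    rw [mem_KX] at *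
    rw [← map_smul, hz, map_zero]
  · rintro z ⟨w, hw⟩
    refine ⟨e.symm w, ?_⟩
    apply e.injective
    simpa using hw

lemma H_zero {V : Type*} [AddCommGroup V] [Module R V] :
    subl (ZC x y p V 0) (BC x y p V 0) ≤ Module.length R (V ⧸ IX x V 1) := by
  rw [← Module.length_top, ← subl_bot ⊤ ⊥ rfl]
  let φ : (ℕ → V) →ₗ[R] (V ⧸ IX x V 1) := (IX x V 1).mkQ.comp (LinearMap.proj 0)
  refine subl_le _ _ _ _ φ.graph ?_ ?_
  · intro z hz; exact ⟨φ z, trivial, by simp [LinearMap.mem_graph_iff]⟩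
  · intro z hz w hw hq hb
    rw [LinearMap.mem_graph_iff] at hq
    rw [Submodule.mem_bot] at hb
    simp only at hq
    rw [hb] at hq
    obtain ⟨v, hv⟩ := (Submodule.Quotient.mk_eq_zero _).1 hq.symm
    refine ⟨fun s => if s = 1 then v else 0, fun s hs => ?_⟩
    obtain rfl : s = 0 := by omega
    rw [dC_apply]
    simp only [LinearMap.lsmul_apply, LinearMap.proj_apply] at hv
    simp [ee_one, ← hv]

lemma H_even (hp : 2 ≤ p) {V : Type*} [AddCommGroup V] [Module R V] (hx : ∀ v : V, x ^ (p - 1) • v = 0)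
    (hy : ∀ v : V, y ^ (p - 1) • v = 0) (hyx : ∀ v : V, ∃ w : V, y • v = x • w) (n : ℕ) (hn : 1 ≤ n) :
    Module.length R (V ⧸ IX x V 1) + Module.length R (V ⧸ IX x V 1) ≤
    subl (ZC x y p V (2 * n)) (BC x y p V (2 * n)) := by
  rw [← Module.length_prod, ← Module.length_top, ← subl_bot ⊤ ⊥ rfl]
  let φ : (ℕ → V) →ₗ[R] (V ⧸ IX x V 1) × (V ⧸ IX x V 1) :=
    ((IX x V 1).mkQ.comp (LinearMap.proj 0)).prod ((IX x V 1).mkQ.comp (LinearMap.proj (2 * n)))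
  have hI : ∀ w s, s ≤ 2 * n → dC x y p V (2 * n + 1) w s ∈ IX x V 1 := by
    intro w s hs
    rw [dC_apply]
    apply Submodule.add_mem
    · refine ⟨x ^ (ee p (s + 1) - 1) • w (s + 1), ?_⟩
      have := ee_pos hp (s + 1)
      rw [LinearMap.lsmul_apply, smul_smul, ← pow_add, show 1 + (ee p (s + 1) - 1) = ee p (s + 1) by omega]
    · rw [← smul_smul]
      apply Submodule.smul_mem
      have := ee_pos hp (2 * n + 1 - s)
      rw [show ee p (2 * n + 1 - s) = 1 + (ee p (2 * n + 1 - s) - 1) by omega, pow_add, pow_one, ← smul_smul]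
      obtain ⟨v, hv⟩ := hyx (y ^ (ee p (2 * n + 1 - s) - 1) • w s)
      exact ⟨v, by rw [hv]; simp⟩
  refine subl_le _ _ _ _ (φ.graph.map (LinearEquiv.prodComm R _ _).toLinearMap) ?_ ?_
  · rintro ⟨a, b⟩ -
    obtain ⟨a, rfl⟩ := Submodule.mkQ_surjective _ a
    obtain ⟨b, rfl⟩ := Submodule.mkQ_surjective _ b
    let z : ℕ → V := fun s => if s = 0 then a else if s = 2 * n then b else 0
    refine ⟨z, ?_, ?_⟩
    · intro s hs
      rw [dC_apply]
      have h1 : x ^ ee p (s + 1) • z (s + 1) = 0 := by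
        by_cases h : s + 1 = 2 * n
        · rw [h, ee_even]; exact hx _
        · simp [z, h]
      have h2 : ((-1) ^ s * y ^ ee p (2 * n - s)) • z s = 0 := by
        by_cases h : s = 0
        · subst h; rw [Nat.sub_zero, ee_even, ← smul_smul, hy, smul_zero]
        · simp [z, h, show s ≠ 2 * n by omega]
      rw [h1, h2, add_zero]
    · refine ⟨(z, φ z), by simp [LinearMap.mem_graph_iff], ?_⟩
      have : 2 * n ≠ 0 := by omega
      have hn0 : n ≠ 0 := by omega
      simp [φ, z, hn0]
  · rintro q - z hz ⟨⟨z', q'⟩, hg, he⟩ ⟨w, hw⟩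
    rw [SetLike.mem_coe, LinearMap.mem_graph_iff] at hg
    simp only [LinearEquiv.coe_coe, LinearEquiv.prodComm_apply, Prod.swap_prod_mk, Prod.mk.injEq] at he hg
    obtain ⟨rfl, rfl⟩ := he
    rw [Submodule.mem_bot, hg]
    refine Prod.ext ?_ ?_
    · refine (Submodule.Quotient.mk_eq_zero _).2 ?_
      have := hI w 0 (by omega)
      rw [← hw 0 (by omega)] at this
      exact this
    · refine (Submodule.Quotient.mk_eq_zero _).2 ?_
      have := hI w (2 * n) (by omega)
      rw [← hw _ (by omega)] at this
      exact this

lemma eig {k V W : Type*} [Field k] [IsAlgClosed k] [AddCommGroup V] [Module k V] [AddCommGroup W] [Module k W]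
    [FiniteDimensional k V] (α β : V →ₗ[k] W) (hα : Function.Injective α)
    (hβ : LinearMap.range β ≤ LinearMap.range α)
    (h : ∀ c : k, LinearMap.range α ≤ LinearMap.range (β - c • α)) : Subsingleton V := by
  by_contra hV
  rw [not_subsingleton_iff_nontrivial] at hV
  let e := LinearEquiv.ofInjective α hα
  let b : V →ₗ[k] LinearMap.range α := β.codRestrict _ (fun v => hβ ⟨v, rfl⟩)
  let ψ : V →ₗ[k] V := e.symm.toLinearMap.comp b
  have hψ : ∀ v, α (ψ v) = β v := by
    intro v
    have : e (ψ v) = b v := by simp [ψ]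
    exact congrArg Subtype.val this
  obtain ⟨c, hc⟩ := Module.End.exists_eigenvalue (K := k) (V := V) ψ
  obtain ⟨v, hv⟩ := hc.exists_hasEigenvector
  have hs : Function.Surjective (ψ - c • (LinearMap.id : V →ₗ[k] V)) := by
    intro w
    obtain ⟨u, hu⟩ := h c ⟨w, rfl⟩
    refine ⟨u, hα ?_⟩
    rw [← hu]
    simp [hψ]
  have hi := LinearMap.injective_iff_surjective.2 hs
  apply hv.2
  apply hi
  simp [hv.apply_eq_smul]
end gen

section spec

lemma mem_span2 {k : Type} [Field k] (a b : ℕ) (f : MvPolynomial (Fin 2) k) :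
    f ∈ Ideal.span {(X 0 : MvPolynomial (Fin 2) k) ^ a, (X 1 : MvPolynomial (Fin 2) k) ^ b} ↔
      ∀ m ∈ f.support, a ≤ m 0 ∨ b ≤ m 1 := by
  have h : ({(X 0 : MvPolynomial (Fin 2) k) ^ a, (X 1 : MvPolynomial (Fin 2) k) ^ b} : Set _) =
      (fun s => monomial s (1 : k)) '' {Finsupp.single 0 a, Finsupp.single 1 b} := by
    simp [Set.image_pair, X_pow_eq_monomial]
  rw [h, mem_ideal_span_monomial_image]
  simp

lemma span_shift0 {k : Type} [Field k] (a b j : ℕ) (hj : j ≤ a) (f : MvPolynomial (Fin 2) k)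
    (h : X 0 ^ j * f ∈ Ideal.span {(X 0 : MvPolynomial (Fin 2) k) ^ a, (X 1 : MvPolynomial (Fin 2) k) ^ b}) :
    f ∈ Ideal.span {(X 0 : MvPolynomial (Fin 2) k) ^ (a - j), (X 1 : MvPolynomial (Fin 2) k) ^ b} := by
  rw [mem_span2] at *
  intro m hm
  have := h (Finsupp.single 0 j + m) (by
    rw [MvPolynomial.mem_support_iff, X_pow_eq_monomial, coeff_monomial_mul, one_mul]; exact MvPolynomial.mem_support_iff.1 hm)
  simp at this
  omega

lemma span_shift1 {k : Type} [Field k] (a b j : ℕ) (hj : j ≤ b) (f : MvPolynomial (Fin 2) k)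
    (h : X 1 ^ j * f ∈ Ideal.span {(X 0 : MvPolynomial (Fin 2) k) ^ a, (X 1 : MvPolynomial (Fin 2) k) ^ b}) :
    f ∈ Ideal.span {(X 0 : MvPolynomial (Fin 2) k) ^ a, (X 1 : MvPolynomial (Fin 2) k) ^ (b - j)} := by
  rw [mem_span2] at *
  intro m hm
  have := h (Finsupp.single 1 j + m) (by
    rw [MvPolynomial.mem_support_iff, X_pow_eq_monomial, coeff_monomial_mul, one_mul]; exact MvPolynomial.mem_support_iff.1 hm)
  simp at this
  omega

lemma xA_pow (k : Type) [Field k] (p : ℕ) : xA k p ^ p = 0 := by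
  rw [xA, ← map_pow, Ideal.Quotient.eq_zero_iff_mem]
  exact Ideal.subset_span (by simp)

lemma yA_pow (k : Type) [Field k] (p : ℕ) : yA k p ^ p = 0 := by
  rw [yA, ← map_pow, Ideal.Quotient.eq_zero_iff_mem]
  exact Ideal.subset_span (by simp)

lemma goodA (k : Type) [Field k] (p : ℕ) (hp : 1 ≤ p) : GoodF (xA k p) (yA k p) p (Amod k p) where
  xk := by
    intro j hj f hf
    obtain ⟨f, rfl⟩ := Ideal.Quotient.mk_surjective f
    rw [smul_eq_mul, xA, ← map_pow, ← map_mul, Ideal.Quotient.eq_zero_iff_mem] at hf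
    have := span_shift0 _ _ _ hj f hf
    rw [Ideal.mem_span_pair] at this
    obtain ⟨a, b, rfl⟩ := this
    refine ⟨Ideal.Quotient.mk _ a, ?_⟩
    have hy : (Ideal.Quotient.mk (relI k p)) (X 1) ^ p = 0 := yA_pow k p
    simp only [map_add, map_mul, map_pow, smul_eq_mul, xA, hy]
    ring
  yk := by
    intro j hj f g hf
    obtain ⟨f, rfl⟩ := Ideal.Quotient.mk_surjective f
    obtain ⟨g, rfl⟩ := Ideal.Quotient.mk_surjective g
    rw [smul_eq_mul, smul_eq_mul, xA, yA, ← map_pow, ← map_mul, ← map_mul, Ideal.Quotient.eq] at hf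
    have h1 : X 1 ^ j * f ∈ Ideal.span {(X 0 : MvPolynomial (Fin 2) k) ^ 1, (X 1 : MvPolynomial (Fin 2) k) ^ p} := by
      rw [relI, Ideal.mem_span_pair] at hf
      obtain ⟨a, b, hab⟩ := hf
      rw [Ideal.mem_span_pair]
      refine ⟨g + a * X 0 ^ (p - 1), b, ?_⟩
      have : (X 0 : MvPolynomial (Fin 2) k) ^ p = X 0 ^ (p - 1) * X 0 := by
        rw [← pow_succ]; congr 1; omega
      rw [this] at hab
      linear_combination hab
    have := span_shift1 _ _ _ hj f h1
    rw [Ideal.mem_span_pair] at this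
    obtain ⟨a, b, rfl⟩ := this
    refine ⟨Ideal.Quotient.mk _ a, Ideal.Quotient.mk _ b, ?_⟩
    simp only [map_add, map_mul, map_pow, smul_eq_mul, xA, yA]
    ring

lemma goodFree (k : Type) [Field k] (p : ℕ) (hp : 1 ≤ p) (r : ℕ) :
    GoodF (xA k p) (yA k p) p (Fin r → Amod k p) where
  xk := by
    intro j hj f hf
    choose g hg using fun i => (goodA k p hp).xk j hj (f i) (congrFun hf i)
    exact ⟨g, funext hg⟩
  yk := by
    intro j hj f g hf
    choose a b hg using fun i => (goodA k p hp).yk j hj (f i) (g i) (congrFun hf i)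
    exact ⟨a, b, funext hg⟩

lemma finA (k : Type) [Field k] (p : ℕ) (hp : 1 ≤ p) : Module.Finite k (Amod k p) := by
  have hgen : Algebra.adjoin k (Set.range fun i : Fin 2 => Ideal.Quotient.mk (relI k p) (X i)) = ⊤ := by
    have := (Ideal.Quotient.mkₐ k (relI k p)).map_adjoin (Set.range (X : Fin 2 → MvPolynomial (Fin 2) k))
    rw [adjoin_range_X, Algebra.map_top, ← Set.range_comp] at this
    rw [AlgHom.range_eq_top _ |>.2 (Ideal.Quotient.mkₐ_surjective k _)] at this
    exact this.symm
  rw [Module.finite_def, ← Algebra.top_toSubmodule, ← hgen]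
  apply fg_adjoin_of_finite (Set.finite_range _)
  rintro _ ⟨i, rfl⟩
  refine IsIntegral.of_pow (n := p) (by omega) ?_
  have : Ideal.Quotient.mk (relI k p) (X i) ^ p = 0 := by
    fin_cases i
    · exact xA_pow k p
    · exact yA_pow k p
  rw [this]
  exact isIntegral_zero

lemma fin_syz (k : Type) [Field k] (p : ℕ) : ∀ (m : ℕ) (N M : ModuleCat.{0} (Amod k p)),
    IsMinSyz k p m N M → Module.Finite (Amod k p) M → Module.Finite (Amod k p) N
  | 0, N, M, h, hM => by
    obtain ⟨e⟩ := h
    exact Module.Finite.equiv e.symm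
  | (m + 1), N, M, h, hM => by
    obtain ⟨r, g, h1, h2, h3⟩ := h
    refine fin_syz k p m N _ h3 ?_
    exact inferInstanceAs (Module.Finite (Amod k p) (LinearMap.ker g))

lemma H_syz (k : Type) [Field k] (p : ℕ) (hp : 2 ≤ p) (i : ℕ) : ∀ (m : ℕ) (N M : ModuleCat.{0} (Amod k p)),
    IsMinSyz k p m N M → subl (ZC (xA k p) (yA k p) p M (i + m)) (BC (xA k p) (yA k p) p M (i + m)) ≤
      subl (ZC (xA k p) (yA k p) p N i) (BC (xA k p) (yA k p) p N i)
  | 0, N, M, h => by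
    obtain ⟨e⟩ := h
    exact congr_H e.symm i
  | (m + 1), N, M, h => by
    obtain ⟨r, g, h1, h2, h3⟩ := h
    exact (shift_H hp (xA_pow k p) (yA_pow k p) (goodFree k p (by omega) r) g h1 (i + m)).trans
      (H_syz k p hp i m N _ h3)

lemma T_syz (k : Type) [Field k] (p : ℕ) (hp : 3 ≤ p) : ∀ (n : ℕ) (N M : ModuleCat.{0} (Amod k p)),
    IsMinSyz k p (2 * n) N M → PP (xA k p) p M →
    PP (xA k p) p N ∧ subl (KX (xA k p) N 1) (IX (xA k p) N (p - 1)) ≤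
      subl (KX (xA k p) M 1) (IX (xA k p) M (p - 1))
  | 0, N, M, h, hP => by
    obtain ⟨e⟩ := h
    refine ⟨?_, congr_T e 1 (p - 1)⟩
    intro v hv
    obtain ⟨w, hw⟩ := hP (e v) (by rw [← map_smul, hv, map_zero])
    refine ⟨e.symm w, e.injective ?_⟩
    simpa using hw
  | (n + 1), N, M, h, hP => by
    obtain ⟨r, g, h1, h2, r', g', h1', h2', h3⟩ := h
    have hF := goodFree k p (by omega) r
    have hF' := goodFree k p (by omega) r'
    have hQ := PQ_of_PP hp (xA_pow k p) hF g h1 hP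
    have hP' := PP_of_PQ hp (xA_pow k p) hF' g' h1' hQ
    obtain ⟨a, b⟩ := T_syz k p hp n N _ h3 hP'
    refine ⟨a, b.trans ?_⟩
    have s1 := shift_T (xA_pow k p) hF' g' h1' 1 (by omega)
    have s2 := shift_T (xA_pow k p) hF g h1 (p - 1) (by omega)
    rw [show p - (p - 1) = 1 by omega] at s2
    exact s1.trans s2

lemma eip_range {k : Type} [Field k] {p : ℕ} {N : Type} [AddCommGroup N] [Module (Amod k p) N]
    (h : EIP k p N) {u v : Amod k p} (hu : IsPointOp k p u) (hv : IsPointOp k p v) (n : N) :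
    ∃ n' : N, u • n = v • n' := by
  have h1 : u • n ∈ LinearMap.range (LinearMap.lsmul (Amod k p) N u) := ⟨n, rfl⟩
  rw [h u hu, ← h v hv] at h1
  obtain ⟨w, hw⟩ := h1
  exact ⟨w, hw.symm⟩

lemma pt_x (k : Type) [Field k] (p : ℕ) : IsPointOp k p (xA k p) := ⟨1, 0, by simp, by simp⟩
lemma pt_y (k : Type) [Field k] (p : ℕ) : IsPointOp k p (yA k p) := ⟨0, 1, by simp, by simp⟩
lemma pt_c (k : Type) [Field k] (p : ℕ) (c : k) : IsPointOp k p (yA k p - c • xA k p) :=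
  ⟨-c, 1, by simp, by rw [neg_smul, one_smul]; abel⟩

lemma eip_nil (k : Type) [Field k] [IsAlgClosed k] (p : ℕ) (hp : 5 ≤ p) (N : Type) [AddCommGroup N]
    [Module (Amod k p) N] [Module.Finite (Amod k p) N] (hE : EIP k p N) (hP : PP (xA k p) p N) (v : N) :
    xA k p ^ 2 • v = 0 := by
  set x := xA k p with hx
  set y := yA k p with hy
  let : Module k N := Module.compHom N (algebraMap k (Amod k p))
  have : IsScalarTower k (Amod k p) N := ⟨fun a b c =>
    (congrArg (fun t : Amod k p => t • c) (Algebra.smul_def a b)).trans (mul_smul _ _ _)⟩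
  have := finA k p (by omega)
  have : Module.Finite k N := Module.Finite.trans (Amod k p) N
  let S : Submodule (Amod k p) N := (IX x N 3).comap (LinearMap.lsmul (Amod k p) N (x ^ 2))
  have hS : ∀ u : Amod k p, IsPointOp k p u →
      S ≤ LinearMap.ker ((IX x N 4).mkQ.comp (LinearMap.lsmul (Amod k p) N (x ^ 2 * u))) := by
    rintro u hu n ⟨l, hl⟩
    refine (Submodule.Quotient.mk_eq_zero _).2 ?_
    obtain ⟨l', hl'⟩ := eip_range hE hu (pt_x k p) l
    refine ⟨l', ?_⟩
    simp only [LinearMap.lsmul_apply] at hl ⊢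
    rw [mul_comm, ← smul_smul u, ← hl, smul_comm, hl', smul_smul, ← pow_succ]
  let al : ∀ u : Amod k p, IsPointOp k p u → ((N ⧸ S) →ₗ[Amod k p] (N ⧸ IX x N 4)) :=
    fun u hu => S.liftQ _ (hS u hu)
  have al_mk : ∀ u hu n, al u hu (S.mkQ n) = (IX x N 4).mkQ ((x ^ 2 * u) • n) := fun u hu n => rfl
  have al_range : ∀ u hu u' hu' (q : N ⧸ S), ∃ q', al u hu q = al u' hu' q' := by
    intro u hu u' hu' q
    obtain ⟨n, rfl⟩ := S.mkQ_surjective q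
    obtain ⟨n', hn'⟩ := eip_range hE hu hu' n
    exact ⟨S.mkQ n', by rw [al_mk u hu, al_mk u' hu', mul_smul, mul_smul, hn']⟩
  have inj : Function.Injective (al x (pt_x k p)) := by
    rw [← LinearMap.ker_eq_bot, LinearMap.ker_eq_bot']
    intro q hq
    obtain ⟨n, rfl⟩ := S.mkQ_surjective q
    rw [al_mk x (pt_x k p)] at hq
    obtain ⟨l, hl⟩ := (Submodule.Quotient.mk_eq_zero _).1 hq
    refine (Submodule.Quotient.mk_eq_zero _).2 ?_
    simp only [LinearMap.lsmul_apply] at hl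
    obtain ⟨w, hw⟩ := hP (n - x • l) (by
      rw [smul_sub, smul_smul, ← pow_succ, hl, ← pow_succ, sub_self])
    refine ⟨l + x ^ (p - 4) • w, ?_⟩
    simp only [LinearMap.lsmul_apply]
    rw [smul_sub, sub_eq_iff_eq_add] at hw
    rw [hw, smul_add, smul_smul, smul_smul, ← pow_add, ← pow_succ, show 3 + (p - 4) = p - 1 by omega, add_comm]
  have sub := eig (k := k) ((al x (pt_x k p)).restrictScalars k) ((al y (pt_y k p)).restrictScalars k) inj
    (by
      rintro _ ⟨q, rfl⟩
      obtain ⟨q', h⟩ := al_range y (pt_y k p) x (pt_x k p) q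
      exact ⟨q', h.symm⟩)
    (by
      rintro c _ ⟨q, rfl⟩
      obtain ⟨q', h⟩ := al_range x (pt_x k p) _ (pt_c k p c) q
      refine ⟨q', ?_⟩
      rw [LinearMap.coe_restrictScalars, h]
      obtain ⟨n, rfl⟩ := S.mkQ_surjective q'
      simp only [LinearMap.sub_apply, LinearMap.smul_apply, LinearMap.coe_restrictScalars]
      rw [al_mk _ (pt_c k p c), al_mk x (pt_x k p), al_mk y (pt_y k p), mul_sub, sub_smul, map_sub, mul_smul_comm, smul_assoc]
      rfl)
  have hall : ∀ n : N, ∃ l, x ^ 2 • n = x ^ 3 • l := by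
    intro n
    obtain ⟨l, hl⟩ := (Submodule.Quotient.mk_eq_zero S).1 (Subsingleton.elim (S.mkQ n) 0)
    exact ⟨l, hl.symm⟩
  have hpow : ∀ j, ∃ l, x ^ 2 • v = x ^ (2 + j) • l := by
    intro j
    induction j with
    | zero => exact ⟨v, rfl⟩
    | succ j ih =>
      obtain ⟨l, hl⟩ := ih
      obtain ⟨l', hl'⟩ := hall l
      refine ⟨l', ?_⟩
      rw [hl, add_comm, pow_add, mul_smul, hl', smul_smul, ← pow_add]
      congr 2; omega
  obtain ⟨l, hl⟩ := hpow (p - 2)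
  rw [hl, show 2 + (p - 2) = p by omega, hx, xA_pow]
  exact zero_smul (Amod k p) l

end spec

/-- for `p ≥ 5` and `M ≠ 0` in `EIP_2`, no minimal `2n`-th syzygy of `M`
(`n ≥ 1`) has the equal images property. -/
theorem minEvenSyz_not_EIP_of_EIPtwo
    [IsAlgClosed k] [Fact p.Prime] [CharP k p] (hp5 : 5 ≤ p)
    (M : Type) [AddCommGroup M] [Module (Amod k p) M]
    [Module k M] [IsScalarTower k (Amod k p) M] [FiniteDimensional k M]
    (hM : Nontrivial M) (hE : EIPd k p 2 M)
    (n : ℕ) (hn : 1 ≤ n) :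
    ∀ (N : Type) [AddCommGroup N] [Module (Amod k p) N],
      IsMinSyz k p (2 * n) (ModuleCat.of (Amod k p) N) (ModuleCat.of (Amod k p) M) →
      ¬ EIP k p N := by
  intro N _ _ hN hEN
  have hp1 : 1 ≤ p := by omega
  have := finA k p hp1
  have : IsArtinianRing (Amod k p) := IsArtinianRing.of_finite k (Amod k p)
  have : Module.Finite (Amod k p) M := Module.Finite.of_restrictScalars_finite k (Amod k p) M
  have : Module.Finite (Amod k p) N :=
    fin_syz k p _ _ _ hN (show Module.Finite (Amod k p) M from inferInstance)
  -- products of two elements of the maximal ideal kill `M`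
  have hkill : ∀ a ∈ mA k p, ∀ b ∈ mA k p, ∀ v : M, (a * b) • v = 0 := by
    intro a ha b hb v
    have : (a * b) • v ∈ (mA k p) ^ 2 • (⊤ : Submodule (Amod k p) M) := by
      refine Submodule.smul_mem_smul ?_ Submodule.mem_top
      rw [pow_two]; exact Ideal.mul_mem_mul ha hb
    rw [hE.2] at this
    exact this
  have hxm : xA k p ∈ mA k p := Ideal.subset_span (by simp)
  have hym : yA k p ∈ mA k p := Ideal.subset_span (by simp)
  have hpow : ∀ z ∈ mA k p, ∀ j, 2 ≤ j → ∀ v : M, z ^ j • v = 0 := by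
    intro z hz j hj v
    obtain ⟨i, rfl⟩ := Nat.exists_eq_add_of_le hj
    rw [pow_add, mul_smul, pow_two]; exact hkill _ hz _ hz _
  have hPM : PP (xA k p) p M := fun v _ => ⟨0, by rw [hpow _ hxm 2 le_rfl, smul_zero]⟩
  obtain ⟨hPN, hT⟩ := T_syz k p (by omega) n _ _ hN hPM
  have hnil := eip_nil k p hp5 N hEN hPN
  have hH := H_syz k p (by omega) 0 (2 * n) _ _ hN
  rw [zero_add] at hH
  have hH1 := H_even (R := Amod k p) (p := p) (x := xA k p) (y := yA k p) (V := M) (by omega)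
    (hpow _ hxm _ (by omega)) (hpow _ hym _ (by omega)) (eip_range hE.1 (pt_y k p) (pt_x k p)) n hn
  have hH0 := H_zero (R := Amod k p) (p := p) (x := xA k p) (y := yA k p) (V := N)
  have hbM : IX (xA k p) M (p - 1) = ⊥ := by
    rw [eq_bot_iff]; rintro _ ⟨v, rfl⟩; exact hpow _ hxm _ (by omega) v
  have hbN : IX (xA k p) N (p - 1) = ⊥ := by
    rw [eq_bot_iff]; rintro _ ⟨v, rfl⟩
    rw [Submodule.mem_bot, LinearMap.lsmul_apply, show p - 1 = (p - 3) + 2 by omega, pow_add, mul_smul,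
      hnil, smul_zero]
  have eN : subl (KX (xA k p) N 1) (IX (xA k p) N (p - 1)) = Module.length (Amod k p) (N ⧸ IX (xA k p) N 1) := by
    rw [subl_bot _ _ hbN]; exact (length_top_eq_ker _).symm
  have eM : subl (KX (xA k p) M 1) (IX (xA k p) M (p - 1)) = Module.length (Amod k p) (M ⧸ IX (xA k p) M 1) := by
    rw [subl_bot _ _ hbM]; exact (length_top_eq_ker _).symm
  have hfin : Module.length (Amod k p) (M ⧸ IX (xA k p) M 1) ≠ ⊤ := Module.length_ne_top
  have hle : Module.length (Amod k p) (M ⧸ IX (xA k p) M 1) + Module.length (Amod k p) (M ⧸ IX (xA k p) M 1)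
      ≤ Module.length (Amod k p) (M ⧸ IX (xA k p) M 1) := by
    calc _ ≤ _ := hH1
      _ ≤ _ := hH
      _ ≤ _ := hH0
      _ = _ := eN.symm
      _ ≤ _ := hT
      _ = _ := eM
  have h0 : Module.length (Amod k p) (M ⧸ IX (xA k p) M 1) = 0 := by
    generalize Module.length (Amod k p) (M ⧸ IX (xA k p) M 1) = l at hle hfin
    lift l to ℕ using hfin
    norm_cast at hle ⊢
    omega
  rw [Module.length_eq_zero_iff] at h0
  have hdiv : ∀ v : M, ∃ w : M, v = xA k p • w := by
    intro v
    obtain ⟨w, hw⟩ := (Submodule.Quotient.mk_eq_zero (IX (xA k p) M 1)).1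
      (Subsingleton.elim ((IX (xA k p) M 1).mkQ v) 0)
    exact ⟨w, by rw [← hw]; simp⟩
  obtain ⟨v, hv⟩ := exists_ne (0 : M)
  obtain ⟨w, rfl⟩ := hdiv v
  obtain ⟨w', rfl⟩ := hdiv w
  apply hv
  rw [smul_smul]; exact hkill _ hxm _ hxm _

end
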